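/- Let p ∈ (0,1) and set s = -1/ln(1-p). Then the ProbDD update of p after a failed deletion of a subset of size s, namely p / (1 - (1-p)^{s}), equals p / (1 - e^{-1}). In particular the probability is multiplied by the constant factor 1/(1-e^{-1}). -/

import Mathlib

open Real

/-- For `p ∈ (0,1)` and `s = -1/log(1-p)`, the ProbDD failure update
`p / (1 - (1-p)^s)` equals `p / (1 - exp (-1))`. -/
theorem probdd_update_constant_factor (p : ℝ) (hp0 : 0 < p) (hp1 : p < 1)
    (s : ℝ) (hs : s = -1 / Real.log (1 - p)) :
    p / (1 - (1 - p) ^ s) = p / (1 - Real.exp (-1)) ∧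
    p / (1 - (1 - p) ^ s) = (1 / (1 - Real.exp (-1))) * p := by
  have hlog : Real.log (1 - p) ≠ 0 := (Real.log_neg (by linarith) (by linarith)).ne
  have hpow : (1 - p) ^ s = Real.exp (-1) := by
    rw [hs, Real.rpow_def_of_pos (by linarith), mul_div_cancel₀ _ hlog]
  rw [hpow]
  exact ⟨rfl, by ring⟩
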